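/- For all positive integers k and n, m(n,J_k) ≤ 3k·2^{8k}·n. -/

import Mathlib

open Filter

/-- A binary matrix `A` contains a binary matrix `P` (as a submatrix pattern):
there are strictly increasing choices of rows and columns such that `A` has a
one wherever `P` does. -/
def ContainsMat {k l m n : ℕ} (P : Fin k → Fin l → Bool) (A : Fin m → Fin n → Bool) : Prop :=
  ∃ (r : Fin k → Fin m) (c : Fin l → Fin n), StrictMono r ∧ StrictMono c ∧
    ∀ i j, P i j = true → A (r i) (c j) = true

/-- The permutation matrix of a permutation of `{1,…,k}`. -/
def permMatrix {k : ℕ} (π : Equiv.Perm (Fin k)) : Fin k → Fin k → Bool :=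
  fun i j => decide (π i = j)

/-- The mass of a binary matrix: the number of its one-entries. -/
def mass {m n : ℕ} (A : Fin m → Fin n → Bool) : ℕ :=
  (Finset.univ.filter fun p : Fin m × Fin n => A p.1 p.2 = true).card

/-- A binary matrix avoids a permutation if it avoids its permutation matrix. -/
def AvoidsPerm {k m n : ℕ} (A : Fin m → Fin n → Bool) (π : Equiv.Perm (Fin k)) : Prop :=
  ¬ ContainsMat (permMatrix π) A

/-- `ex n π`: the maximum mass of an `n × n` binary matrix avoiding `π`. -/
noncomputable def exP {k : ℕ} (n : ℕ) (π : Equiv.Perm (Fin k)) : ℕ :=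
  sSup {m | ∃ A : Fin n → Fin n → Bool, AvoidsPerm A π ∧ mass A = m}

/-- `ex n U` for a set `U` of permutations: the maximum mass of an `n × n`
binary matrix avoiding every permutation in `U`. -/
noncomputable def exU {k : ℕ} (n : ℕ) (U : Finset (Equiv.Perm (Fin k))) : ℕ :=
  sSup {m | ∃ A : Fin n → Fin n → Bool, (∀ π ∈ U, AvoidsPerm A π) ∧ mass A = m}

/-- An `n`-permutation `σ` contains a `k`-permutation `π`. -/
def PermContains {n k : ℕ} (σ : Equiv.Perm (Fin n)) (π : Equiv.Perm (Fin k)) : Prop :=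
  ∃ x : Fin k → Fin n, StrictMono x ∧ ∀ i j, σ (x i) < σ (x j) ↔ π i < π j

/-- `S n π`: the number of `n`-permutations avoiding `π`. -/
noncomputable def SP {k : ℕ} (n : ℕ) (π : Equiv.Perm (Fin k)) : ℕ :=
  Nat.card {σ : Equiv.Perm (Fin n) // ¬ PermContains σ π}

/-- `S n U`: the number of `n`-permutations avoiding every permutation in `U`. -/
noncomputable def SU {k : ℕ} (n : ℕ) (U : Finset (Equiv.Perm (Fin k))) : ℕ :=
  Nat.card {σ : Equiv.Perm (Fin n) // ∀ π ∈ U, ¬ PermContains σ π}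

/-- `T n π`: the number of `n × n` binary matrices avoiding `π`. -/
noncomputable def TP {k : ℕ} (n : ℕ) (π : Equiv.Perm (Fin k)) : ℕ :=
  Nat.card {A : Fin n → Fin n → Bool // AvoidsPerm A π}

/-- `P` is an interval minor of `A`: there are ordered disjoint row intervals
`[rlo a, rhi a]` and column intervals `[clo b, chi b]` such that wherever `P`
has a one, the corresponding block of `A` contains a one. -/
def IntervalMinor {k l m n : ℕ} (P : Fin k → Fin l → Bool) (A : Fin m → Fin n → Bool) : Prop :=
  ∃ (rlo rhi : Fin k → Fin m) (clo chi : Fin l → Fin n),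
    (∀ a, rlo a ≤ rhi a) ∧ (∀ a b, a < b → rhi a < rlo b) ∧
    (∀ a, clo a ≤ chi a) ∧ (∀ a b, a < b → chi a < clo b) ∧
    ∀ a b, P a b = true → ∃ i j, rlo a ≤ i ∧ i ≤ rhi a ∧ clo b ≤ j ∧ j ≤ chi b ∧ A i j = true

/-- The all-ones `k × l` binary matrix. -/
def J (k l : ℕ) : Fin k → Fin l → Bool := fun _ _ => true

/-- `m n P`: the maximum mass of an `n × n` binary matrix avoiding `P` as an
interval minor. -/
noncomputable def mP {k l : ℕ} (n : ℕ) (P : Fin k → Fin l → Bool) : ℕ :=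
  sSup {m | ∃ A : Fin n → Fin n → Bool, ¬ IntervalMinor P A ∧ mass A = m}

/-- `f_P(t,s)`: the supremum (in `ℕ∞`) of those `N` for which there is an
`N × t` binary matrix with at least `s` ones in each row avoiding `P` as an
interval minor. -/
noncomputable def fP {k l : ℕ} (P : Fin k → Fin l → Bool) (t s : ℕ) : ℕ∞ :=
  sSup {x : ℕ∞ | ∃ N : ℕ, x = (N : ℕ∞) ∧ ∃ A : Fin N → Fin t → Bool,
    (∀ i, s ≤ (Finset.univ.filter fun j => A i j = true).card) ∧ ¬ IntervalMinor P A}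

/-- `g_P(t,s)`: the supremum (in `ℕ∞`) of those `N` for which there is a
`t × N` binary matrix with at least `s` ones in each column avoiding `P` as an
interval minor. -/
noncomputable def gP {k l : ℕ} (P : Fin k → Fin l → Bool) (t s : ℕ) : ℕ∞ :=
  sSup {x : ℕ∞ | ∃ N : ℕ, x = (N : ℕ∞) ∧ ∃ A : Fin t → Fin N → Bool,
    (∀ j, s ≤ (Finset.univ.filter fun i => A i j = true).card) ∧ ¬ IntervalMinor P A}

/-- Interval minor via monotone labels. -/
def HasJ (l k : ℕ) (R : ℕ → ℕ → Prop) : Prop :=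
  ∃ α β : ℕ → ℕ, Monotone α ∧ Monotone β ∧
    ∀ a < l, ∀ b < k, ∃ i j, R i j ∧ α i = a ∧ β j = b

theorem hasJ_swap {l k : ℕ} {R : ℕ → ℕ → Prop} (h : HasJ l k (fun i j => R j i)) :
    HasJ k l R := by
  obtain ⟨α, β, hα, hβ, h⟩ := h
  refine ⟨β, α, hβ, hα, fun a ha b hb => ?_⟩
  obtain ⟨i, j, h1, h2, h3⟩ := h b hb a ha
  exact ⟨j, i, h1, h3, h2⟩

theorem lemBase (l : ℕ) (S : Finset ℕ) (hc : l ≤ S.card) :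
    ∃ α : ℕ → ℕ, Monotone α ∧ ∀ a < l, ∃ i ∈ S, α i = a := by
  classical
  refine ⟨fun i => (S.filter (· < i)).card, ?_, ?_⟩
  · intro x y hxy
    apply Finset.card_le_card
    intro z hz
    simp only [Finset.mem_filter] at hz ⊢
    exact ⟨hz.1, by omega⟩
  · intro a ha
    have ha' : a < S.card := by omega
    refine ⟨S.orderEmbOfFin rfl ⟨a, ha'⟩, Finset.orderEmbOfFin_mem _ _ _, ?_⟩
    have : S.filter (· < S.orderEmbOfFin rfl ⟨a, ha'⟩) =
        (Finset.univ.filter (fun x : Fin S.card => x < ⟨a, ha'⟩)).image (S.orderEmbOfFin rfl) := by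
      ext z
      simp only [Finset.mem_filter, Finset.mem_image, Finset.mem_univ, true_and]
      constructor
      · rintro ⟨hz, hlt⟩
        have : z ∈ Set.range (S.orderEmbOfFin rfl) := by
          rw [Finset.range_orderEmbOfFin]; exact hz
        obtain ⟨w, rfl⟩ := this
        exact ⟨w, (S.orderEmbOfFin rfl).lt_iff_lt.1 hlt, rfl⟩
      · rintro ⟨w, hw, rfl⟩
        exact ⟨Finset.orderEmbOfFin_mem _ _ _, (S.orderEmbOfFin rfl).lt_iff_lt.2 hw⟩
    simp only [this]
    rw [Finset.card_image_of_injective _ (S.orderEmbOfFin rfl).injective]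
    have h2 : (Finset.univ.filter (fun x : Fin S.card => x < ⟨a, ha'⟩)) = Finset.Iio ⟨a, ha'⟩ := by
      ext; simp
    rw [h2, Fin.card_Iio]

theorem lemF (l : ℕ) (R : ℕ → ℕ → Prop) (e : ℕ) : ∀ (k c : ℕ) (S : Finset ℕ),
    (∀ i ∈ S, ∃ T : Finset ℕ, 2 ^ k ≤ T.card ∧ ∀ j ∈ T, c ≤ j ∧ j < c + 2 ^ e ∧ R i j) →
    l * 4 ^ e ≤ S.card →
    ∃ α β : ℕ → ℕ, Monotone α ∧ Monotone β ∧ ∀ a < l, (∃ i ∈ S, α i = a) ∧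
      ∀ b < k, ∃ i ∈ S, ∃ j, c ≤ j ∧ j < c + 2 ^ e ∧ R i j ∧ α i = a ∧ β j = b := by
  classical
  induction e with
  | zero =>
    intro k c S hS hc
    rcases k with _ | k
    · obtain ⟨α, hα, h⟩ := lemBase l S (by simpa using hc)
      exact ⟨α, id, hα, monotone_id, fun a ha => ⟨h a ha, by simp⟩⟩
    · have hSe : S = ∅ := by
        by_contra hne
        obtain ⟨i, hi⟩ := Finset.nonempty_iff_ne_empty.2 hne
        obtain ⟨T, hT, hT'⟩ := hS i hi
        have : T ⊆ {c} := by
          intro j hj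
          have := hT' j hj
          simp at this ⊢
          omega
        have := Finset.card_le_card this
        have h2 : 1 ≤ 2 ^ k := Nat.one_le_two_pow
        simp only [pow_succ, Finset.card_singleton] at this hT
        omega
      subst hSe
      have : l = 0 := by simpa using hc
      subst this
      exact ⟨id, id, monotone_id, monotone_id, by simp⟩
  | succ e ih =>
    intro k c S hS hc
    have hp : 2 ^ (e + 1) = 2 ^ e + 2 ^ e := by ring
    have hq : l * 4 ^ (e + 1) = l * 4 ^ e + l * 4 ^ e + l * 4 ^ e + l * 4 ^ e := by ring
    have hr : 2 ^ (k + 1) = 2 ^ k + 2 ^ k := by ring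
    rcases k with _ | k
    · obtain ⟨α, hα, h⟩ := lemBase l S (by
        have : 1 ≤ 4 ^ (e+1) := Nat.one_le_pow _ _ (by norm_num)
        nlinarith)
      exact ⟨α, id, hα, monotone_id, fun a ha => ⟨h a ha, by simp⟩⟩
    · have hr : 2 ^ (k + 1) = 2 ^ k + 2 ^ k := by ring
      have hk1 : 1 ≤ 2 ^ k := Nat.one_le_two_pow
      choose! T hT hT' using hS
      let Lf : ℕ → Finset ℕ := fun i => (T i).filter (· < c + 2 ^ e)
      let Rt : ℕ → Finset ℕ := fun i => (T i).filter (¬ · < c + 2 ^ e)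
      have hLR : ∀ i, (Lf i).card + (Rt i).card = (T i).card := fun i =>
        Finset.card_filter_add_card_filter_not _
      have hL : ∀ i ∈ S, ∀ j ∈ Lf i, c ≤ j ∧ j < c + 2 ^ e ∧ R i j := by
        intro i hi j hj
        have hj := Finset.mem_filter.1 hj
        have := hT' i hi j hj.1
        exact ⟨this.1, hj.2, this.2.2⟩
      have hR : ∀ i ∈ S, ∀ j ∈ Rt i, c + 2 ^ e ≤ j ∧ j < c + 2 ^ e + 2 ^ e ∧ R i j := by
        intro i hi j hj
        have hj := Finset.mem_filter.1 hj
        have := hT' i hi j hj.1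
        exact ⟨by omega, by omega, this.2.2⟩
      let S1 := S.filter (fun i => (Rt i).card = 0)
      let S2 := S.filter (fun i => (Lf i).card = 0)
      let S3 := S.filter (fun i => 2 ^ k ≤ (Lf i).card ∧ 0 < (Rt i).card)
      let S4 := S.filter (fun i => 2 ^ k ≤ (Rt i).card ∧ 0 < (Lf i).card)
      have hcov : S ⊆ S1 ∪ S2 ∪ S3 ∪ S4 := by
        intro i hi
        have h1 := hT i hi
        have h2 := hLR i
        simp only [S1, S2, S3, S4, Finset.mem_union, Finset.mem_filter, hi, true_and]
        omega
      have hcard : S.card ≤ S1.card + S2.card + S3.card + S4.card := by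
        refine (Finset.card_le_card hcov).trans ?_
        refine (Finset.card_union_le _ _).trans (Nat.add_le_add_right ?_ _)
        refine (Finset.card_union_le _ _).trans (Nat.add_le_add_right ?_ _)
        exact Finset.card_union_le _ _
      have hcases : l * 4 ^ e ≤ S1.card ∨ l * 4 ^ e ≤ S2.card ∨ l * 4 ^ e ≤ S3.card ∨
          l * 4 ^ e ≤ S4.card := by omega
      rcases hcases with h | h | h | h
      · obtain ⟨α, β, hα, hβ, hh⟩ := ih (k+1) c S1 (fun i hi => by
          have hi := Finset.mem_filter.1 hi
          refine ⟨Lf i, ?_, hL i hi.1⟩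
          have h1 := hT i hi.1
          have h2 := hLR i
          omega) h
        refine ⟨α, β, hα, hβ, fun a ha => ⟨?_, fun b hb => ?_⟩⟩
        · obtain ⟨i, hi, hi'⟩ := (hh a ha).1
          exact ⟨i, (Finset.mem_filter.1 hi).1, hi'⟩
        · obtain ⟨i, hi, j, h1, h2, h3⟩ := (hh a ha).2 b hb
          exact ⟨i, (Finset.mem_filter.1 hi).1, j, h1, by omega, h3⟩
      · obtain ⟨α, β, hα, hβ, hh⟩ := ih (k+1) (c + 2 ^ e) S2 (fun i hi => by
          have hi := Finset.mem_filter.1 hi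
          refine ⟨Rt i, ?_, hR i hi.1⟩
          have h1 := hT i hi.1
          have h2 := hLR i
          omega) h
        refine ⟨α, β, hα, hβ, fun a ha => ⟨?_, fun b hb => ?_⟩⟩
        · obtain ⟨i, hi, hi'⟩ := (hh a ha).1
          exact ⟨i, (Finset.mem_filter.1 hi).1, hi'⟩
        · obtain ⟨i, hi, j, h1, h2, h3⟩ := (hh a ha).2 b hb
          exact ⟨i, (Finset.mem_filter.1 hi).1, j, by omega, by omega, h3⟩
      · obtain ⟨α, β, hα, hβ, hh⟩ := ih k c S3 (fun i hi => by
          have hi := Finset.mem_filter.1 hi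
          exact ⟨Lf i, hi.2.1, hL i hi.1⟩) h
        refine ⟨α, fun j => if j < c + 2 ^ e then min (β j) k else k, hα, ?_,
          fun a ha => ⟨?_, fun b hb => ?_⟩⟩
        · intro x y hxy
          have := hβ hxy
          dsimp only
          split_ifs <;> omega
        · obtain ⟨i, hi, hi'⟩ := (hh a ha).1
          exact ⟨i, (Finset.mem_filter.1 hi).1, hi'⟩
        · by_cases hbk : b < k
          · obtain ⟨i, hi, j, h1, h2, h3, h4, h5⟩ := (hh a ha).2 b hbk
            refine ⟨i, (Finset.mem_filter.1 hi).1, j, h1, by omega, h3, h4, ?_⟩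
            dsimp only
            rw [if_pos h2]; omega
          · obtain ⟨i, hi, hi'⟩ := (hh a ha).1
            have hi := Finset.mem_filter.1 hi
            obtain ⟨j, hj⟩ := Finset.card_pos.1 hi.2.2
            have := hR i hi.1 j hj
            refine ⟨i, hi.1, j, by omega, by omega, this.2.2, hi', ?_⟩
            dsimp only
            rw [if_neg (by omega)]; omega
      · obtain ⟨α, β, hα, hβ, hh⟩ := ih k (c + 2 ^ e) S4 (fun i hi => by
          have hi := Finset.mem_filter.1 hi
          exact ⟨Rt i, hi.2.1, hR i hi.1⟩) h
        refine ⟨α, fun j => if j < c + 2 ^ e then 0 else β j + 1, hα, ?_,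
          fun a ha => ⟨?_, fun b hb => ?_⟩⟩
        · intro x y hxy
          have := hβ hxy
          dsimp only
          split_ifs <;> omega
        · obtain ⟨i, hi, hi'⟩ := (hh a ha).1
          exact ⟨i, (Finset.mem_filter.1 hi).1, hi'⟩
        · rcases b with _ | b
          · obtain ⟨i, hi, hi'⟩ := (hh a ha).1
            have hi := Finset.mem_filter.1 hi
            obtain ⟨j, hj⟩ := Finset.card_pos.1 hi.2.2
            have := hL i hi.1 j hj
            refine ⟨i, hi.1, j, by omega, by omega, this.2.2, hi', ?_⟩
            dsimp only
            rw [if_pos (by omega)]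
          · obtain ⟨i, hi, j, h1, h2, h3, h4, h5⟩ := (hh a ha).2 b (by omega)
            refine ⟨i, (Finset.mem_filter.1 hi).1, j, by omega, by omega, h3, h4, ?_⟩
            dsimp only
            rw [if_neg (by omega)]; omega

/-- few wide blocks -/
theorem wide_bound (k n' : ℕ) (R : ℕ → ℕ → Prop) (hR : ¬ HasJ k k R)
    (W : Finset (ℕ × ℕ)) (hW : ∀ q ∈ W, q.2 < n' ∧ ∃ T : Finset ℕ, 2 ^ k ≤ T.card ∧
      ∀ j ∈ T, ∃ i, R i j ∧ i / 2 ^ (2 * k) = q.1 ∧ j / 2 ^ (2 * k) = q.2) :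
    W.card ≤ n' * (k * 4 ^ (2 * k)) := by
  classical
  have h1 : ∀ y ∈ Finset.range n', (W.filter (fun q => q.2 = y)).card ≤ k * 4 ^ (2 * k) := by
    intro y _
    by_contra hlt
    push Not at hlt
    have hinj : ((W.filter (fun q => q.2 = y)).image Prod.fst).card =
        (W.filter (fun q => q.2 = y)).card := by
      apply Finset.card_image_of_injOn
      rintro ⟨a, b⟩ h1 ⟨a', b'⟩ h2 h
      simp at h1 h2 h
      ext <;> simp <;> omega
    obtain ⟨α, β, hα, hβ, h⟩ := lemF k
      (fun x j => ∃ i, R i j ∧ i / 2 ^ (2 * k) = x) (2 * k) k (y * 2 ^ (2 * k))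
      ((W.filter (fun q => q.2 = y)).image Prod.fst) (by
        intro x hx
        obtain ⟨q, hq, rfl⟩ := Finset.mem_image.1 hx
        obtain ⟨hq1, rfl⟩ := Finset.mem_filter.1 hq
        obtain ⟨_, T, hT, hT'⟩ := hW q hq1
        refine ⟨T, hT, fun j hj => ?_⟩
        obtain ⟨i, h1, h2, h3⟩ := hT' j hj
        have hpos : 0 < 2 ^ (2 * k) := by positivity
        refine ⟨?_, ?_, i, h1, h2⟩
        · rw [← h3]; exact Nat.div_mul_le_self _ _
        · rw [← h3]; have := Nat.lt_div_mul_add hpos (a := j); omega) (by omega)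
    apply hR
    refine ⟨fun i => α (i / 2 ^ (2 * k)), β, ?_, hβ, fun a ha b hb => ?_⟩
    · intro x y hxy
      exact hα (Nat.div_le_div_right hxy)
    · obtain ⟨x, _, j, _, _, ⟨i, hi, rfl⟩, h4, h5⟩ := (h a ha).2 b hb
      exact ⟨i, j, hi, h4, h5⟩
  have := Finset.card_le_mul_card_image_of_maps_to (s := W) (t := Finset.range n') (f := Prod.snd)
    (fun q hq => by simpa using (hW q hq).1) (k * 4 ^ (2 * k)) h1
  simpa [mul_comm] using this

theorem arith (k n n' : ℕ) (hk : 0 < k) (hn' : n' = n / 2 ^ (2 * k) + 1)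
    (hn : 3 * k * 2 ^ (8 * k) < n) :
    (3 * k * 2 ^ (8 * k) * n') * (2 ^ k - 1) ^ 2 +
      (n' * (k * 4 ^ (2 * k)) + n' * (k * 4 ^ (2 * k))) * (2 ^ (2 * k)) ^ 2
      ≤ 3 * k * 2 ^ (8 * k) * n := by
  have e1 : 2 ^ (8 * k) = (2 ^ k) ^ 8 := by rw [← pow_mul, mul_comm]
  have e2 : 2 ^ (2 * k) = (2 ^ k) ^ 2 := by rw [← pow_mul, mul_comm]
  have e3 : 4 ^ (2 * k) = (2 ^ k) ^ 4 := by
    rw [show 4 = 2 ^ 2 by norm_num, ← pow_mul, ← pow_mul]; ring_nf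
  rw [e1] at hn
  rw [e2] at hn'
  rw [e1, e2, e3]
  have hs : 2 ≤ 2 ^ k := by
    calc 2 = 2 ^ 1 := by norm_num
      _ ≤ 2 ^ k := Nat.pow_le_pow_right (by norm_num) hk
  generalize 2 ^ k = s at *
  obtain ⟨r, rfl⟩ : ∃ r, s = r + 1 := ⟨s - 1, by omega⟩
  have hr : 1 ≤ r := by omega
  simp only [Nat.add_sub_cancel]
  have h1 : (r + 1) ^ 2 * n' ≤ n + (r + 1) ^ 2 := by
    rw [hn']
    have := Nat.div_mul_le_self n ((r + 1) ^ 2)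
    nlinarith
  have h0 : (r + 1) ^ 4 ≤ n := by
    have : (r + 1) ^ 4 ≤ (r + 1) ^ 8 := Nat.pow_le_pow_right (by omega) (by norm_num)
    nlinarith
  have h2 : n' * (r ^ 2 + 1) ≤ n := by
    have : (r + 1) ^ 2 * (n' * (r ^ 2 + 1)) ≤ (r + 1) ^ 2 * n := by
      calc (r + 1) ^ 2 * (n' * (r ^ 2 + 1)) = ((r + 1) ^ 2 * n') * (r ^ 2 + 1) := by ring
        _ ≤ (n + (r + 1) ^ 2) * (r ^ 2 + 1) := Nat.mul_le_mul_right _ h1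
        _ = n * (r ^ 2 + 1) + (r + 1) ^ 2 * (r ^ 2 + 1) := by ring
        _ ≤ n * (r ^ 2 + 1) + (r + 1) ^ 2 * (r + 1) ^ 2 := by
            gcongr; nlinarith
        _ = n * (r ^ 2 + 1) + (r + 1) ^ 4 := by ring
        _ ≤ n * (r ^ 2 + 1) + n * (2 * r) := by nlinarith
        _ = (r + 1) ^ 2 * n := by ring
    exact Nat.le_of_mul_le_mul_left this (by positivity)
  calc _ = (3 * k * (r + 1) ^ 8) * (n' * r ^ 2) + 2 * k * (r + 1) ^ 8 * n' := by ring
    _ ≤ (3 * k * (r + 1) ^ 8) * (n' * r ^ 2) + 3 * k * (r + 1) ^ 8 * n' := by gcongr; norm_num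
    _ = (3 * k * (r + 1) ^ 8) * (n' * (r ^ 2 + 1)) := by ring
    _ ≤ _ := Nat.mul_le_mul_left _ h2

theorem core (k : ℕ) (hk : 0 < k) (n : ℕ) : ∀ E : Finset (ℕ × ℕ),
    (∀ p ∈ E, p.1 < n ∧ p.2 < n) → ¬ HasJ k k (fun i j => (i, j) ∈ E) →
    E.card ≤ 3 * k * 2 ^ (8 * k) * n := by
  classical
  induction n using Nat.strong_induction_on with
  | _ n ih =>
  intro E hE hJ
  by_cases hn : n ≤ 3 * k * 2 ^ (8 * k)
  · have : E ⊆ Finset.range n ×ˢ Finset.range n := by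
      intro p hp
      simpa using hE p hp
    have := Finset.card_le_card this
    simp at this
    nlinarith
  push Not at hn
  obtain ⟨n', hn'⟩ : ∃ n', n' = n / 2 ^ (2 * k) + 1 := ⟨_, rfl⟩
  refine le_trans ?_ (arith k n n' hk hn' hn)
  have hlt : n' < n := by
    have h4 : 2 ≤ 2 ^ (2 * k) := by
      calc 2 = 2 ^ 1 := by norm_num
        _ ≤ 2 ^ (2 * k) := Nat.pow_le_pow_right (by norm_num) (by omega)
    have h5 : n / 2 ^ (2 * k) ≤ n / 2 := Nat.div_le_div_left h4 (by norm_num)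
    have : 1 ≤ 2 ^ (8 * k) := Nat.one_le_two_pow
    have : 3 ≤ 3 * k * 2 ^ (8 * k) := by nlinarith
    omega
  obtain ⟨φ, hφ⟩ : ∃ φ : ℕ × ℕ → ℕ × ℕ, ∀ p, φ p = (p.1 / 2 ^ (2 * k), p.2 / 2 ^ (2 * k)) :=
    ⟨_, fun _ => rfl⟩
  let E' := E.image φ
  have hE'n : ∀ q ∈ E', q.1 < n' ∧ q.2 < n' := by
    intro q hq
    obtain ⟨p, hp, rfl⟩ := Finset.mem_image.1 hq
    rw [hφ, hn']
    have := hE p hp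
    exact ⟨Nat.lt_succ_of_le (Nat.div_le_div_right this.1.le),
      Nat.lt_succ_of_le (Nat.div_le_div_right this.2.le)⟩
  have hE' : E'.card ≤ 3 * k * 2 ^ (8 * k) * n' := by
    apply ih n' hlt E' hE'n
    rintro ⟨α, β, hα, hβ, h⟩
    apply hJ
    refine ⟨fun i => α (i / 2 ^ (2 * k)), fun i => β (i / 2 ^ (2 * k)),
      fun x y hxy => hα (Nat.div_le_div_right hxy), fun x y hxy => hβ (Nat.div_le_div_right hxy),
      fun a ha b hb => ?_⟩
    obtain ⟨x, y, hxy, h1, h2⟩ := h a ha b hb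
    obtain ⟨p, hp, hp'⟩ := Finset.mem_image.1 hxy
    rw [hφ] at hp'
    simp only [Prod.mk.injEq] at hp'
    refine ⟨p.1, p.2, hp, ?_, ?_⟩
    · dsimp only; rw [hp'.1, h1]
    · dsimp only; rw [hp'.2, h2]
  let Fb : ℕ × ℕ → Finset (ℕ × ℕ) := fun q => E.filter (fun p => φ p = q)
  have hFb : ∀ q, ∀ p ∈ Fb q, p ∈ E ∧ p.1 / 2 ^ (2 * k) = q.1 ∧ p.2 / 2 ^ (2 * k) = q.2 := by
    intro q p hp
    have hp := Finset.mem_filter.1 hp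
    rw [hφ] at hp
    exact ⟨hp.1, by rw [← hp.2], by rw [← hp.2]⟩
  let W := E'.filter (fun q => 2 ^ k ≤ ((Fb q).image Prod.snd).card)
  let V := E'.filter (fun q => 2 ^ k ≤ ((Fb q).image Prod.fst).card)
  have hW : W.card ≤ n' * (k * 4 ^ (2 * k)) := by
    apply wide_bound k n' _ hJ
    intro q hq
    obtain ⟨hq, hq'⟩ := Finset.mem_filter.1 hq
    refine ⟨(hE'n q hq).2, _, hq', ?_⟩
    intro j hj
    obtain ⟨p, hp, rfl⟩ := Finset.mem_image.1 hj
    have := hFb q p hp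
    exact ⟨p.1, this⟩
  have hV : V.card ≤ n' * (k * 4 ^ (2 * k)) := by
    rw [← Finset.card_image_of_injective V Prod.swap_injective]
    apply wide_bound k n' _ (fun h => hJ (hasJ_swap h))
    intro q hq
    obtain ⟨q, hqV, rfl⟩ := Finset.mem_image.1 hq
    obtain ⟨hq, hq'⟩ := Finset.mem_filter.1 hqV
    refine ⟨(hE'n q hq).1, _, hq', ?_⟩
    intro j hj
    obtain ⟨p, hp, rfl⟩ := Finset.mem_image.1 hj
    have := hFb q p hp
    exact ⟨p.2, this.1, this.2.2, this.2.1⟩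
  have hprod : ∀ q, (Fb q).card ≤ ((Fb q).image Prod.fst).card * ((Fb q).image Prod.snd).card := by
    intro q
    rw [← Finset.card_product]
    apply Finset.card_le_card
    intro p hp
    exact Finset.mem_product.2 ⟨Finset.mem_image_of_mem _ hp, Finset.mem_image_of_mem _ hp⟩
  have hdiv : ∀ (X : Finset ℕ) (y : ℕ), (∀ j ∈ X, j / 2 ^ (2 * k) = y) → X.card ≤ 2 ^ (2 * k) := by
    intro X y h
    have hpos : 0 < 2 ^ (2 * k) := by positivity
    have : X ⊆ Finset.Ico (y * 2 ^ (2 * k)) (y * 2 ^ (2 * k) + 2 ^ (2 * k)) := by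
      intro j hj
      rw [Finset.mem_Ico, ← h j hj]
      exact ⟨Nat.div_mul_le_self _ _, Nat.lt_div_mul_add hpos⟩
    simpa using Finset.card_le_card this
  have hall : ∀ q, (Fb q).card ≤ (2 ^ (2 * k)) ^ 2 := by
    intro q
    rw [sq]
    refine (hprod q).trans (Nat.mul_le_mul (hdiv _ q.1 ?_) (hdiv _ q.2 ?_))
    · intro j hj
      obtain ⟨p, hp, rfl⟩ := Finset.mem_image.1 hj
      exact (hFb q p hp).2.1
    · intro j hj
      obtain ⟨p, hp, rfl⟩ := Finset.mem_image.1 hj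
      exact (hFb q p hp).2.2
  have hsum : E.card = ∑ q ∈ E', (Fb q).card :=
    Finset.card_eq_sum_card_fiberwise (fun p hp => Finset.mem_image_of_mem _ hp)
  have hsplit : ∀ q ∈ E', (Fb q).card ≤ (2 ^ k - 1) ^ 2 +
      ((if 2 ^ k ≤ ((Fb q).image Prod.snd).card then (2 ^ (2 * k)) ^ 2 else 0) +
      (if 2 ^ k ≤ ((Fb q).image Prod.fst).card then (2 ^ (2 * k)) ^ 2 else 0)) := by
    intro q _
    have h1 := hall q
    split_ifs with ha hb hb
    · omega
    · omega
    · omega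
    · rw [sq (2 ^ k - 1)]
      exact (hprod q).trans (Nat.mul_le_mul (by omega) (by omega))
  rw [hsum]
  refine (Finset.sum_le_sum hsplit).trans ?_
  rw [Finset.sum_add_distrib, Finset.sum_add_distrib, ← Finset.sum_filter, ← Finset.sum_filter]
  simp only [Finset.sum_const, smul_eq_mul]
  rw [← add_mul]
  gcongr

theorem minor_of_hasJ (k n : ℕ) (hk : 0 < k) (A : Fin n → Fin n → Bool)
    (h : HasJ k k (fun i j => ∃ (hi : i < n) (hj : j < n), A ⟨i, hi⟩ ⟨j, hj⟩ = true)) :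
    IntervalMinor (J k k) A := by
  classical
  obtain ⟨α, β, hα, hβ, h⟩ := h
  have key : ∀ γ : ℕ → ℕ, Monotone γ → (∀ a < k, ∃ i, i < n ∧ γ i = a) →
      ∃ lo hi : Fin k → Fin n, (∀ a, lo a ≤ hi a) ∧ (∀ a b, a < b → hi a < lo b) ∧
        ∀ a : Fin k, ∀ i : Fin n, γ i = a → lo a ≤ i ∧ i ≤ hi a := by
    intro γ hγ hs
    have hne : ∀ a : Fin k, (Finset.univ.filter (fun i : Fin n => γ i = a)).Nonempty := by
      intro a
      obtain ⟨i, hi, h⟩ := hs a a.2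
      exact ⟨⟨i, hi⟩, by simpa using h⟩
    refine ⟨fun a => Finset.min' _ (hne a), fun a => Finset.max' _ (hne a),
      fun a => Finset.min'_le_max' _ _, ?_, ?_⟩
    · intro a b hab
      have h1 := Finset.max'_mem _ (hne a)
      have h2 := Finset.min'_mem _ (hne b)
      rw [Finset.mem_filter] at h1 h2
      by_contra hle
      push Not at hle
      have := hγ (Fin.le_def.1 hle)
      rw [h1.2, h2.2] at this
      have := Fin.lt_def.1 hab
      omega
    · intro a i hi
      have hm : i ∈ Finset.univ.filter (fun i : Fin n => γ i = a) := by simpa using hi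
      exact ⟨Finset.min'_le _ _ hm, Finset.le_max' _ _ hm⟩
  obtain ⟨rlo, rhi, r1, r2, r3⟩ := key α hα (fun a ha => by
    obtain ⟨i, j, ⟨hi, hj, _⟩, h1, h2⟩ := h a ha 0 hk
    exact ⟨i, hi, h1⟩)
  obtain ⟨clo, chi, c1, c2, c3⟩ := key β hβ (fun a ha => by
    obtain ⟨i, j, ⟨hi, hj, _⟩, h1, h2⟩ := h 0 hk a ha
    exact ⟨j, hj, h2⟩)
  refine ⟨rlo, rhi, clo, chi, r1, r2, c1, c2, fun a b _ => ?_⟩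
  obtain ⟨i, j, ⟨hi, hj, hA⟩, h1, h2⟩ := h a a.2 b b.2
  have x := r3 a ⟨i, hi⟩ h1
  have y := c3 b ⟨j, hj⟩ h2
  exact ⟨⟨i, hi⟩, ⟨j, hj⟩, x.1, x.2, y.1, y.2, hA⟩

/-- For all positive integers `k` and `n`,
`m(n,J_k) ≤ 3k·2^{8k}·n`. -/
theorem stmt19 (k n : ℕ) (hk : 0 < k) (hn : 0 < n) :
    mP n (J k k) ≤ 3 * k * 2 ^ (8 * k) * n := by
  classical
  apply csSup_le'
  rintro m ⟨A, hA, rfl⟩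
  unfold mass
  have hinj : Function.Injective (fun p : Fin n × Fin n => ((p.1 : ℕ), (p.2 : ℕ))) := by
    rintro ⟨a, b⟩ ⟨c, d⟩ h
    simp only [Prod.mk.injEq] at h
    exact Prod.ext (Fin.ext h.1) (Fin.ext h.2)
  rw [← Finset.card_image_of_injective _ hinj]
  apply core k hk n
  · intro p hp
    obtain ⟨q, _, rfl⟩ := Finset.mem_image.1 hp
    exact ⟨q.1.2, q.2.2⟩
  · intro h
    apply hA
    apply minor_of_hasJ k n hk
    obtain ⟨α, β, hα, hβ, h⟩ := h
    refine ⟨α, β, hα, hβ, fun a ha b hb => ?_⟩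
    obtain ⟨i, j, hm, h1⟩ := h a ha b hb
    obtain ⟨q, hq, hq'⟩ := Finset.mem_image.1 hm
    simp only [Prod.mk.injEq] at hq'
    obtain ⟨rfl, rfl⟩ := hq'
    exact ⟨_, _, ⟨q.1.2, q.2.2, (Finset.mem_filter.1 hq).2⟩, h1⟩
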